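/- Let T be a finite rooted binary tree with leaf assignment χ, let P(T) be any path decomposition of T, let p ∈ P(T), and let q_1, ..., q_k be the children of p in the shrub of P(T). Then |H_{ℓ(p)}| + Σ_{i=1}^{k} |H_{q_i}| ≤ |H_p| + 2|p|. -/

import Mathlib

open scoped Classical
noncomputable section

/-- A finite rooted binary tree on vertex set `V`: every non-root vertex has a parent,
the root has none, depths are consistent (ensuring acyclicity), and each vertex has
at most two children. -/
structure RBTree (V : Type) [Fintype V] [DecidableEq V] where
  parent : V → Option V
  root : V
  depth : V → ℕ
  parent_root : parent root = none
  root_of_parent_none : ∀ v, parent v = none → v = root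
  depth_parent : ∀ v u, parent v = some u → depth v = depth u + 1
  binary : ∀ v : V, (Finset.univ.filter (fun c => parent c = some v)).card ≤ 2

namespace RBTree

variable {V : Type} [Fintype V] [DecidableEq V]

/-- The children of a vertex. -/
def children (T : RBTree V) (v : V) : Finset V :=
  Finset.univ.filter (fun c => T.parent c = some v)

/-- A leaf is a vertex with no children. -/
def IsLeaf (T : RBTree V) (v : V) : Prop := T.children v = ∅

/-- Iterated parent map. -/
def parentIter (T : RBTree V) : ℕ → V → Option V
  | 0, v => some v
  | n + 1, v => (T.parentIter n v).bind T.parent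

/-- `u` is a (weak) ancestor of `v`: `u` lies on the path from `v` to the root
(including `v` itself). -/
def Anc (T : RBTree V) (u v : V) : Prop := ∃ n, T.parentIter n v = some u

/-- `u` is a strict ancestor of `v`. -/
def StrictAnc (T : RBTree V) (u v : V) : Prop := ∃ n, 0 < n ∧ T.parentIter n v = some u

/-- `L(T_v)`: the leaves of the subtree rooted at `v`. -/
def subtreeLeaves (T : RBTree V) (v : V) : Finset V :=
  Finset.univ.filter (fun l => T.IsLeaf l ∧ T.Anc v l)

/-- A leaf assignment `χ` assigns to each internal vertex a set of leaves containing
exactly one leaf from the subtree of each of its children (and nothing else);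
leaves are assigned the empty set. -/
structure LeafAssignment (T : RBTree V) where
  χ : V → Finset V
  mem_leaf : ∀ v l, l ∈ χ v → T.IsLeaf l
  mem_desc : ∀ v l, l ∈ χ v → ∃ c ∈ T.children v, T.Anc c l
  unique_child : ∀ v, ∀ c ∈ T.children v, ∃! l, l ∈ χ v ∧ T.Anc c l

/-- The heap `H_v = {u ∈ A(v) : χ(u) ∩ L(T_v) ≠ ∅}` of a vertex `v`. -/
def heap (T : RBTree V) (A : T.LeafAssignment) (v : V) : Finset V :=
  Finset.univ.filter (fun u => T.StrictAnc u v ∧ (A.χ u ∩ T.subtreeLeaves v).Nonempty)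

/-- A leaf path: the set of vertices on a monotone path from some leaf `ℓ` up to an
ancestor `b` of `ℓ`. -/
def IsLeafPath (T : RBTree V) (p : Finset V) : Prop :=
  ∃ ℓ b, T.IsLeaf ℓ ∧ T.Anc b ℓ ∧
    p = Finset.univ.filter (fun u => T.Anc u ℓ ∧ T.Anc b u)

/-- The base `b(p)` of a path: its vertex closest to the root. -/
def base (T : RBTree V) (p : Finset V) : V :=
  if h : ∃ b, b ∈ p ∧ ∀ w ∈ p, T.Anc b w then h.choose else T.root

/-- The leaf `ℓ(p)` of a path. -/
def pathLeaf (T : RBTree V) (p : Finset V) : V :=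
  if h : ∃ l, l ∈ p ∧ ∀ w ∈ p, T.Anc w l then h.choose else T.root

/-- `H_p = H_{b(p)}`. -/
def pathHeap (T : RBTree V) (A : T.LeafAssignment) (p : Finset V) : Finset V :=
  T.heap A (T.base p)

/-- A path decomposition: a partition of the vertex set into leaf paths. -/
def IsPathDecomp (T : RBTree V) (P : Finset (Finset V)) : Prop :=
  (∀ p ∈ P, T.IsLeafPath p) ∧ (∀ v : V, ∃! p, p ∈ P ∧ v ∈ p)

/-- `q` is a child of `p` in the shrub: the parent of `b(q)` lies on `p`. -/
def ShrubParent (T : RBTree V) (p q : Finset V) : Prop :=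
  ∃ u, T.parent (T.base q) = some u ∧ u ∈ p

/-- `p` is a strict ancestor of `q` in the shrub: some vertex of `p` is a strict
ancestor of `b(q)` in `T` (and `p ≠ q`). -/
def ShrubStrictAnc (T : RBTree V) (p q : Finset V) : Prop :=
  p ≠ q ∧ ∃ u ∈ p, T.StrictAnc u (T.base q)

/-- Weak ancestor relation in the shrub. -/
def ShrubAnc (T : RBTree V) (p q : Finset V) : Prop :=
  p = q ∨ T.ShrubStrictAnc p q

/-- A maximum path decomposition w.r.t. a leaf assignment: a path decomposition in
which each internal vertex lies on the same path as a child of maximal heap size. -/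
def IsMaxPathDecomp (T : RBTree V) (A : T.LeafAssignment) (P : Finset (Finset V)) : Prop :=
  T.IsPathDecomp P ∧
    ∀ p ∈ P, ∀ v ∈ p, ∀ c ∈ T.children v, c ∈ p →
      ∀ c' ∈ T.children v, (T.heap A c').card ≤ (T.heap A c).card

/-- A path `p` is short if `|p| < sqrt(|H_p|)/100`. -/
def IsShort (T : RBTree V) (A : T.LeafAssignment) (p : Finset V) : Prop :=
  (p.card : ℝ) < Real.sqrt ((T.pathHeap A p).card) / 100

/-- The tall support chain of a path `p`: the maximal chain of tall paths in the shrub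
starting at the parent of `p` and going up. -/
def TallChain (T : RBTree V) (A : T.LeafAssignment) (P : Finset (Finset V)) (p : Finset V) :
    Finset (Finset V) :=
  P.filter (fun q => T.ShrubStrictAnc q p ∧
    ∀ r ∈ P, T.ShrubStrictAnc r p → T.ShrubAnc q r → ¬ T.IsShort A r)

/-- A short path is supported if at least `|H_p|/100` of the vertices of `H_p` lie on
paths of its tall support chain. -/
def IsSupported (T : RBTree V) (A : T.LeafAssignment) (P : Finset (Finset V))
    (p : Finset V) : Prop :=
  ((T.pathHeap A p).card : ℝ) / 100 ≤
    (((T.pathHeap A p).filter (fun v => ∃ q ∈ T.TallChain A P p, v ∈ q)).card : ℝ)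

/-- The reduced heap `H̃_p`: vertices of `H_p` not lying on the tall support chain. -/
def redHeap (T : RBTree V) (A : T.LeafAssignment) (P : Finset (Finset V))
    (p : Finset V) : Finset V :=
  (T.pathHeap A p).filter (fun v => ∀ q ∈ T.TallChain A P p, v ∉ q)

/-- `q` is the parent of the unsupported short path `p` in the shrub forest of
unsupported short paths: `q` is the first short path on the chain of strict shrub
ancestors of `p`. -/
def ForestParent (T : RBTree V) (A : T.LeafAssignment) (P : Finset (Finset V))
    (q p : Finset V) : Prop :=
  q ∈ P ∧ p ∈ P ∧ T.IsShort A q ∧ T.IsShort A p ∧ ¬ T.IsSupported A P p ∧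
    T.ShrubStrictAnc q p ∧
    ∀ r ∈ P, T.ShrubStrictAnc r p → T.ShrubStrictAnc q r → ¬ T.IsShort A r

/-- `U` is the connected component of the shrub forest of unsupported short paths
rooted at the supported short path `r`. -/
def IsComponent (T : RBTree V) (A : T.LeafAssignment) (P : Finset (Finset V))
    (U : Finset (Finset V)) (r : Finset V) : Prop :=
  U ⊆ P ∧ r ∈ U ∧ T.IsShort A r ∧ T.IsSupported A P r ∧
    (∀ p ∈ U, T.IsShort A p) ∧
    (∀ p ∈ U, p ≠ r → ¬ T.IsSupported A P p) ∧
    (∀ p ∈ U, p ≠ r → ∃ q ∈ U, T.ForestParent A P q p) ∧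
    (∀ q ∈ U, ∀ p ∈ P, T.ForestParent A P q p → p ∈ U)

/-- `q` lies in the subtree of the shrub forest rooted at `p`. -/
def ForestDesc (T : RBTree V) (A : T.LeafAssignment) (P : Finset (Finset V))
    (p q : Finset V) : Prop :=
  Relation.ReflTransGen (fun a b => T.ForestParent A P a b) p q

/-- `U_p`: the nodes of `U` in the subtree of the shrub forest rooted at `p`. -/
def usub (T : RBTree V) (A : T.LeafAssignment) (P : Finset (Finset V))
    (U : Finset (Finset V)) (p : Finset V) : Finset (Finset V) :=
  U.filter (fun q => T.ForestDesc A P p q)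

/-- The children of `p` in the shrub forest (within `U`). -/
def forestChildren (T : RBTree V) (A : T.LeafAssignment) (P : Finset (Finset V))
    (U : Finset (Finset V)) (p : Finset V) : Finset (Finset V) :=
  U.filter (fun q => T.ForestParent A P p q)

/-- The residue `R_p = |H̃_p| − Σ_{q child of p} |H̃_q|`. -/
def residue (T : RBTree V) (A : T.LeafAssignment) (P : Finset (Finset V))
    (U : Finset (Finset V)) (p : Finset V) : ℤ :=
  ((T.redHeap A P p).card : ℤ) -
    ∑ q ∈ T.forestChildren A P U p, ((T.redHeap A P q).card : ℤ)

/-- `R⁺_p = max(R_p, 0)`. -/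
def resPlus (T : RBTree V) (A : T.LeafAssignment) (P : Finset (Finset V))
    (U : Finset (Finset V)) (p : Finset V) : ℤ :=
  max (T.residue A P U p) 0

/-- The weight `W_p = Σ_{q ∈ U_p} R⁺_q`. -/
def weight (T : RBTree V) (A : T.LeafAssignment) (P : Finset (Finset V))
    (U : Finset (Finset V)) (p : Finset V) : ℤ :=
  ∑ q ∈ T.usub A P U p, T.resPlus A P U q

end RBTree

namespace RBTree

variable {V : Type} [Fintype V] [DecidableEq V]

theorem mem_children {T : RBTree V} {c v : V} : c ∈ T.children v ↔ T.parent c = some v := by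
  simp [children]

theorem parentIter_add (T : RBTree V) (m n : ℕ) (v : V) :
    T.parentIter (m + n) v = (T.parentIter n v).bind (T.parentIter m) := by
  induction m with
  | zero => simp [parentIter]
  | succ m ih => rw [Nat.succ_add, parentIter, ih, Option.bind_assoc]; rfl

theorem parentIter_one (T : RBTree V) (v : V) : T.parentIter 1 v = T.parent v := by
  simp [parentIter]

theorem depth_parentIter (T : RBTree V) {n : ℕ} {v u : V} (h : T.parentIter n v = some u) :
    T.depth v = T.depth u + n := by
  induction n generalizing u with
  | zero => simp_all [parentIter]
  | succ n ih =>
    obtain ⟨w, hw, hu⟩ := Option.bind_eq_some_iff.mp h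
    have := ih hw
    have := T.depth_parent w u hu
    omega

theorem Anc.refl (T : RBTree V) (v : V) : T.Anc v v := ⟨0, rfl⟩

theorem Anc.trans {T : RBTree V} {u v w : V} (h : T.Anc u v) (h' : T.Anc v w) : T.Anc u w := by
  obtain ⟨m, hm⟩ := h
  obtain ⟨n, hn⟩ := h'
  exact ⟨m + n, by rw [parentIter_add, hn]; exact hm⟩

theorem Anc.depth_le {T : RBTree V} {u v : V} (h : T.Anc u v) : T.depth u ≤ T.depth v := by
  obtain ⟨n, hn⟩ := h
  have := T.depth_parentIter hn
  omega

theorem Anc.eq_of_depth_eq {T : RBTree V} {u v w : V} (hu : T.Anc u w) (hv : T.Anc v w)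
    (h : T.depth u = T.depth v) : u = v := by
  obtain ⟨m, hm⟩ := hu
  obtain ⟨n, hn⟩ := hv
  have hmd := T.depth_parentIter hm
  have hnd := T.depth_parentIter hn
  obtain rfl : m = n := by omega
  exact Option.some_injective _ (hm.symm.trans hn)

theorem anc_of_parent {T : RBTree V} {c v : V} (h : T.parent c = some v) : T.Anc v c :=
  ⟨1, by rw [parentIter_one, h]⟩

/-- A proper ancestor is an ancestor of the parent. -/
theorem Anc.exists_parent {T : RBTree V} {u v : V} (h : T.Anc u v) (hne : v ≠ u) :
    ∃ w, T.parent v = some w ∧ T.Anc u w := by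
  obtain ⟨_ | n, hn⟩ := h
  · exact absurd (Option.some_injective _ hn) hne
  · rw [parentIter_add, parentIter_one] at hn
    obtain ⟨w, hw, hu⟩ := Option.bind_eq_some_iff.mp hn
    exact ⟨w, hw, n, hu⟩

/-- A proper ancestor has a child on the path to the descendant. -/
theorem Anc.exists_child {T : RBTree V} {u v : V} (h : T.Anc u v) (hne : v ≠ u) :
    ∃ d ∈ T.children u, T.Anc d v := by
  obtain ⟨_ | n, hn⟩ := h
  · exact absurd (Option.some_injective _ hn) hne
  · obtain ⟨d, hd, hu⟩ := Option.bind_eq_some_iff.mp hn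
    exact ⟨d, mem_children.mpr hu, n, hd⟩

theorem StrictAnc.anc {T : RBTree V} {u v : V} (h : T.StrictAnc u v) : T.Anc u v :=
  h.imp fun _ hn => hn.2

theorem StrictAnc.ne {T : RBTree V} {u v : V} (h : T.StrictAnc u v) : v ≠ u := by
  rintro rfl
  obtain ⟨n, hn, h⟩ := h
  have := T.depth_parentIter h
  omega

theorem Anc.strictAnc {T : RBTree V} {u v : V} (h : T.Anc u v) (hne : v ≠ u) :
    T.StrictAnc u v := by
  obtain ⟨n, hn⟩ := h
  refine ⟨n, Nat.pos_of_ne_zero ?_, hn⟩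
  rintro rfl
  exact hne (Option.some_injective _ hn)

theorem IsLeaf.eq_of_anc {T : RBTree V} {l v : V} (hl : T.IsLeaf l) (h : T.Anc l v) : v = l := by
  by_contra hne
  obtain ⟨d, hd, -⟩ := h.exists_child hne
  rw [hl] at hd
  exact Finset.notMem_empty d hd

theorem mem_heap {T : RBTree V} {A : T.LeafAssignment} {u v : V} :
    u ∈ T.heap A v ↔ T.StrictAnc u v ∧ ∃ l ∈ A.χ u, T.Anc v l := by
  simp only [heap, subtreeLeaves, Finset.Nonempty, Finset.mem_filter, Finset.mem_univ, true_and,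
    Finset.mem_inter]
  exact and_congr_right fun _ => exists_congr fun l =>
    ⟨fun h => ⟨h.1, h.2.2⟩, fun h => ⟨h.1, A.mem_leaf u l h.1, h.2⟩⟩

theorem strictAnc_of_mem_heap_child {T : RBTree V} {A : T.LeafAssignment} {u v c : V}
    (hc : T.parent c = some v) (hu : u ∈ T.heap A c) (hne : u ≠ v) : T.StrictAnc u v := by
  have h := (mem_heap.mp hu).1
  obtain ⟨w, hw, huw⟩ := h.anc.exists_parent h.ne
  obtain rfl : v = w := Option.some_injective _ (hc.symm.trans hw)
  exact huw.strictAnc hne.symm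

theorem erase_heap_child_subset {T : RBTree V} {A : T.LeafAssignment} {v c : V}
    (hc : T.parent c = some v) : (T.heap A c).erase v ⊆ T.heap A v := by
  intro u hu
  obtain ⟨hne, hu⟩ := Finset.mem_erase.mp hu
  obtain ⟨-, l, hl, hcl⟩ := mem_heap.mp hu
  exact mem_heap.mpr
    ⟨strictAnc_of_mem_heap_child hc hu hne, l, hl, (anc_of_parent hc).trans hcl⟩

/-- Apart from the vertex itself, the heaps of the children of a vertex are disjoint. -/
theorem disjoint_erase_heap_child {T : RBTree V} {A : T.LeafAssignment} {v c c' : V}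
    (hc : T.parent c = some v) (hc' : T.parent c' = some v) (hne : c ≠ c') :
    Disjoint ((T.heap A c).erase v) ((T.heap A c').erase v) := by
  rw [Finset.disjoint_left]
  intro u hu hu'
  obtain ⟨huv, hu⟩ := Finset.mem_erase.mp hu
  have hu' := Finset.mem_of_mem_erase hu'
  have hs := strictAnc_of_mem_heap_child hc hu huv
  obtain ⟨d, hd, hdv⟩ := hs.anc.exists_child hs.ne
  obtain ⟨-, l, hl, hcl⟩ := mem_heap.mp hu
  obtain ⟨-, l', hl', hcl'⟩ := mem_heap.mp hu'
  obtain rfl : l = l' := (A.unique_child u d hd).unique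
    ⟨hl, (hdv.trans (anc_of_parent hc)).trans hcl⟩
    ⟨hl', (hdv.trans (anc_of_parent hc')).trans hcl'⟩
  exact hne (hcl.eq_of_depth_eq hcl' ((T.depth_parent _ _ hc).trans (T.depth_parent _ _ hc').symm))

theorem sum_card_heap_children_le (T : RBTree V) (A : T.LeafAssignment) (v : V) :
    ∑ c ∈ T.children v, (T.heap A c).card ≤ (T.heap A v).card + 2 := by
  calc ∑ c ∈ T.children v, (T.heap A c).card
      ≤ ∑ c ∈ T.children v, (((T.heap A c).erase v).card + 1) :=
        Finset.sum_le_sum fun c _ => tsub_le_iff_right.mp Finset.pred_card_le_card_erase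
    _ = ((T.children v).biUnion fun c => (T.heap A c).erase v).card + (T.children v).card := by
        rw [Finset.sum_add_distrib, Finset.sum_const, smul_eq_mul, mul_one, Finset.card_biUnion]
        exact fun c hc c' hc' hne =>
          disjoint_erase_heap_child (mem_children.mp hc) (mem_children.mp hc') hne
    _ ≤ (T.heap A v).card + 2 := by
        refine Nat.add_le_add (Finset.card_le_card (Finset.biUnion_subset.mpr fun c hc => ?_)) ?_
        · exact erase_heap_child_subset (mem_children.mp hc)
        · simpa [children] using T.binary v

theorem IsLeafPath.base_spec {T : RBTree V} {p : Finset V} (hp : T.IsLeafPath p) :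
    T.base p ∈ p ∧ ∀ w ∈ p, T.Anc (T.base p) w := by
  obtain ⟨l, b, hl, hbl, rfl⟩ := hp
  have h : ∃ b', b' ∈ Finset.univ.filter (fun u => T.Anc u l ∧ T.Anc b u) ∧
      ∀ w ∈ Finset.univ.filter (fun u => T.Anc u l ∧ T.Anc b u), T.Anc b' w :=
    ⟨b, by simpa using ⟨hbl, Anc.refl T b⟩, by simp⟩
  rw [base, dif_pos h]
  exact h.choose_spec

theorem IsLeafPath.pathLeaf_spec {T : RBTree V} {p : Finset V} (hp : T.IsLeafPath p) :
    T.pathLeaf p ∈ p ∧ T.IsLeaf (T.pathLeaf p) := by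
  obtain ⟨l, b, hl, hbl, rfl⟩ := hp
  have hmem : l ∈ Finset.univ.filter (fun u => T.Anc u l ∧ T.Anc b u) := by
    simpa using ⟨Anc.refl T l, hbl⟩
  have h : ∃ l', l' ∈ Finset.univ.filter (fun u => T.Anc u l ∧ T.Anc b u) ∧
      ∀ w ∈ Finset.univ.filter (fun u => T.Anc u l ∧ T.Anc b u), T.Anc w l' :=
    ⟨l, hmem, by simp +contextual⟩
  rw [pathLeaf, dif_pos h]
  have hs := h.choose_spec
  exact ⟨hs.1, by rwa [hl.eq_of_anc (hs.2 l hmem)]⟩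

theorem IsLeafPath.exists_parent_mem {T : RBTree V} {p : Finset V} (hp : T.IsLeafPath p) {w : V}
    (hw : w ∈ p) (hne : w ≠ T.base p) : ∃ u ∈ p, T.parent w = some u := by
  obtain ⟨hb, hbase⟩ := hp.base_spec
  obtain ⟨u, hu, hbu⟩ := (hbase w hw).exists_parent hne
  obtain ⟨l, b, hl, hbl, rfl⟩ := hp
  simp only [Finset.mem_filter, Finset.mem_univ, true_and] at hb hw
  refine ⟨u, ?_, hu⟩
  simpa using ⟨(anc_of_parent hu).trans hw.1, hb.2.trans hbu⟩

/-- The bound of `sum_card_heap_children_le` summed over a path. -/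
theorem IsLeafPath.card_heap_add_sum_le {T : RBTree V} (A : T.LeafAssignment) {p : Finset V}
    (hp : T.IsLeafPath p) :
    (T.heap A (T.pathLeaf p)).card + ∑ v ∈ p, ∑ c ∈ T.children v, (T.heap A c).card ≤
      ∑ v ∈ p, (T.heap A v).card + 2 * p.card := by
  obtain ⟨hmem, hleaf⟩ := hp.pathLeaf_spec
  have h : ∑ v ∈ p.erase (T.pathLeaf p), ∑ c ∈ T.children v, (T.heap A c).card ≤
      ∑ v ∈ p.erase (T.pathLeaf p), ((T.heap A v).card + 2) :=
    Finset.sum_le_sum fun v _ => T.sum_card_heap_children_le A v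
  rw [Finset.sum_add_distrib, Finset.sum_const, smul_eq_mul] at h
  have hcard := Finset.card_erase_add_one hmem
  rw [← Finset.add_sum_erase p _ hmem,
    ← Finset.add_sum_erase p (fun v => (T.heap A v).card) hmem, hleaf, Finset.sum_empty]
  omega

theorem IsPathDecomp.base_notMem {T : RBTree V} {P : Finset (Finset V)} (hP : T.IsPathDecomp P)
    {p q : Finset V} (hp : p ∈ P) (hq : q ∈ P) (hpq : T.ShrubParent p q) : T.base q ∉ p := by
  intro hmem
  obtain ⟨hb, hbase⟩ := (hP.1 q hq).base_spec
  obtain rfl : q = p := (hP.2 _).unique ⟨hq, hb⟩ ⟨hp, hmem⟩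
  obtain ⟨u, hu, huq⟩ := hpq
  have := (hbase u huq).depth_le
  have := T.depth_parent _ _ hu
  omega

theorem IsPathDecomp.base_injOn {T : RBTree V} {P : Finset (Finset V)} (hP : T.IsPathDecomp P) :
    Set.InjOn T.base (P : Set (Finset V)) := by
  intro q hq r hr h
  exact (hP.2 (T.base q)).unique ⟨hq, (hP.1 q hq).base_spec.1⟩
    ⟨hr, h ▸ (hP.1 r hr).base_spec.1⟩

/-- The non-base vertices of a path and the bases of its shrub children are distinct children
of vertices of the path. -/
theorem IsPathDecomp.sum_erase_add_sum_le {T : RBTree V} {P : Finset (Finset V)}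
    (hP : T.IsPathDecomp P) {p : Finset V} (hp : p ∈ P) (f : V → ℕ) :
    ∑ v ∈ p.erase (T.base p), f v + ∑ q ∈ P.filter (fun q => T.ShrubParent p q), f (T.base q) ≤
      ∑ v ∈ p, ∑ c ∈ T.children v, f c := by
  have hinj : Set.InjOn T.base (P.filter (fun q => T.ShrubParent p q) : Set (Finset V)) :=
    hP.base_injOn.mono (by exact_mod_cast Finset.filter_subset _ P)
  have hdisj : Disjoint (p.erase (T.base p))
      ((P.filter (fun q => T.ShrubParent p q)).image T.base) := by
    rw [Finset.disjoint_right]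
    intro v hv hvp
    obtain ⟨q, hq, rfl⟩ := Finset.mem_image.mp hv
    obtain ⟨hq, hpq⟩ := Finset.mem_filter.mp hq
    exact hP.base_notMem hp hq hpq (Finset.mem_of_mem_erase hvp)
  have hchildren : (p : Set V).PairwiseDisjoint T.children := by
    intro v _ w _ hne
    rw [Function.onFun, Finset.disjoint_left]
    intro c hc hc'
    exact hne (Option.some_injective _
      ((mem_children.mp hc).symm.trans (mem_children.mp hc')))
  rw [← Finset.sum_image hinj, ← Finset.sum_union hdisj, ← Finset.sum_biUnion hchildren]
  refine Finset.sum_le_sum_of_subset fun c hc => ?_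
  simp only [Finset.mem_biUnion, mem_children]
  rcases Finset.mem_union.mp hc with hc | hc
  · exact (hP.1 p hp).exists_parent_mem (Finset.mem_of_mem_erase hc) (Finset.ne_of_mem_erase hc)
  · obtain ⟨q, hq, rfl⟩ := Finset.mem_image.mp hc
    obtain ⟨u, hu, hup⟩ := (Finset.mem_filter.mp hq).2
    exact ⟨u, hup, hu⟩

end RBTree

open RBTree in
/-- for a path `p` of a path decomposition `P(T)` with shrub children
`q_1, ..., q_k`, `|H_{ℓ(p)}| + Σ_i |H_{q_i}| ≤ |H_p| + 2|p|`. -/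
theorem heap_leaf_add_children_le {V : Type} [Fintype V] [DecidableEq V]
    (T : RBTree V) (A : T.LeafAssignment) (P : Finset (Finset V))
    (hP : T.IsPathDecomp P) (p : Finset V) (hp : p ∈ P) :
    (T.heap A (T.pathLeaf p)).card +
        ∑ q ∈ P.filter (fun q => T.ShrubParent p q), (T.pathHeap A q).card ≤
      (T.pathHeap A p).card + 2 * p.card := by
  have hle := (hP.1 p hp).card_heap_add_sum_le A
  have hsum := hP.sum_erase_add_sum_le hp fun v => (T.heap A v).card
  have hbase := Finset.add_sum_erase p (fun v => (T.heap A v).card) (hP.1 p hp).base_spec.1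
  simp only [pathHeap]
  omega
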